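/- arXiv:1606.08545 — 2 statements merged into one kernel-verified Lean document; each statement's English description precedes it below -/
import Mathlib

section
/- Let W₁ and W₂ be symmetric binary-input discrete channels with finite output alphabets Y₁ and Y₂, with symmetry permutations π₁ on Y₁ and π₂ on Y₂. Let (W₁', W₁'') be the single-step polarization transform of (W₁, W₂), and let (W₂', W₂'') be the single-step polarization transform of (W₂, W₁). Then W₁'' is equivalent to W₂'': the map g : Y₁ × Y₂ × Bool → Y₂ × Y₁ × Bool defined by g(y₁, y₂, u₁) = (π₂^{u₁}(y₂), π₁^{u₁}(y₁), u₁) (where π^{u} denotes π when u = true and the identity when u = false) is a bijection satisfying W₁''(x)(z) = W₂''(x)(g z) for all inputs x ∈ Bool and outputs z ∈ Y₁ × Y₂ × Bool. -/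
/-- A binary-input discrete channel with finite output alphabet `Y`:
nonnegative transition probabilities summing to one for each input. -/
def IsChannel {Y : Type} [Fintype Y] (W : Bool → Y → ℝ) : Prop :=
  (∀ x y, 0 ≤ W x y) ∧ ∀ x, ∑ y, W x y = 1

/-- The "minus" channel `W''` of the single-step polarization transform of `(W₁, W₂)`:
`W''(u₂)(y₁, y₂, u₁) = (1/2) · W₁(u₁ ⊕ u₂)(y₁) · W₂(u₂)(y₂)`. -/
noncomputable def polarMinus {Y₁ Y₂ : Type}
    (W₁ : Bool → Y₁ → ℝ) (W₂ : Bool → Y₂ → ℝ) : Bool → Y₁ × Y₂ × Bool → ℝ :=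
  fun u₂ z => (1 / 2) * W₁ (xor z.2.2 u₂) z.1 * W₂ u₂ z.2.1

/-- Flipping the input of a symmetric channel amounts to permuting its output. -/
theorem symmetric_not_apply {Y : Type} {W : Bool → Y → ℝ} {π : Y ≃ Y}
    (hinv : ∀ y, π (π y) = y) (hsym : ∀ y, W true y = W false (π y)) (x : Bool) (y : Y) :
    W (!x) (π y) = W x y := by
  cases x <;> simp [hsym, hinv]

/-- Order reversal for the minus polarized channel of symmetric channels:
the map `g(y₁, y₂, u₁) = (π₂^{u₁} y₂, π₁^{u₁} y₁, u₁)` is a bijection witnessing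
the equivalence of `(W₁,W₂)⁻` and `(W₂,W₁)⁻`. -/
theorem polarMinus_order_equiv {Y₁ Y₂ : Type} [Fintype Y₁] [Fintype Y₂]
    (W₁ : Bool → Y₁ → ℝ) (W₂ : Bool → Y₂ → ℝ)
    (hW₁ : IsChannel W₁) (hW₂ : IsChannel W₂)
    (π₁ : Y₁ ≃ Y₁) (hπ₁inv : ∀ y, π₁ (π₁ y) = y)
    (hπ₁sym : ∀ y, W₁ true y = W₁ false (π₁ y))
    (π₂ : Y₂ ≃ Y₂) (hπ₂inv : ∀ y, π₂ (π₂ y) = y)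
    (hπ₂sym : ∀ y, W₂ true y = W₂ false (π₂ y)) :
    Function.Bijective
      (fun z : Y₁ × Y₂ × Bool =>
        ((if z.2.2 then π₂ z.2.1 else z.2.1, if z.2.2 then π₁ z.1 else z.1, z.2.2) :
          Y₂ × Y₁ × Bool)) ∧
    ∀ (x : Bool) (z : Y₁ × Y₂ × Bool),
      polarMinus W₁ W₂ x z =
        polarMinus W₂ W₁ x
          (if z.2.2 then π₂ z.2.1 else z.2.1, if z.2.2 then π₁ z.1 else z.1, z.2.2) := by
  refine ⟨Function.bijective_iff_has_inverse.mpr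
    ⟨fun z => (if z.2.2 then π₁ z.2.1 else z.2.1, if z.2.2 then π₂ z.1 else z.1, z.2.2),
      ?_, ?_⟩, ?_⟩
  · rintro ⟨y₁, y₂, _ | _⟩ <;> simp [hπ₁inv, hπ₂inv]
  · rintro ⟨y₂, y₁, _ | _⟩ <;> simp [hπ₁inv, hπ₂inv]
  · rintro x ⟨y₁, y₂, _ | _⟩
    · simp only [polarMinus, Bool.false_xor, Bool.false_eq_true, if_false]
      ring
    · have h₁ : W₁ x (π₁ y₁) = W₁ (!x) y₁ := by
        simpa using symmetric_not_apply hπ₁inv hπ₁sym (!x) y₁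
      simp only [polarMinus, Bool.true_xor, if_true, h₁,
        symmetric_not_apply hπ₂inv hπ₂sym]
      ring
end

section
/- Let W be a symmetric binary-input discrete channel with finite output alphabet Y, let n ≥ 1, and let the subset bit-channels W_{n,S}^{(i)} for S ⊆ Fin 2ⁿ and i ∈ Fin 2ⁿ be defined by the recursive polarization construction (base case: for n = 0 and S ⊆ Fin 1, W_{0,S}^{(0)} = W if 0 ∈ S and W_{0,S}^{(0)} = E, the total erasure channel, otherwise; recursive case: for S ⊆ Fin 2^{n+1}, setting S₁ = {s ∈ S : s < 2ⁿ} and S₂ = {s − 2ⁿ : s ∈ S, s ≥ 2ⁿ} viewed as subsets of Fin 2ⁿ, the pair (W_{n+1,S}^{(2i)}, W_{n+1,S}^{(2i+1)}) is the single-step polarization transform of (W_{n,S₁}^{(i)}, W_{n,S₂}^{(i)})). If S, T ⊆ Fin 2ⁿ are equivalent subsets, i.e. S = {t XOR x : t ∈ T} for some x ∈ Fin 2ⁿ where XOR denotes bitwise exclusive-or of the n-bit binary representations, then for every i ∈ Fin 2ⁿ the channels W_{n,S}^{(i)} and W_{n,T}^{(i)} are equivalent. -/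
/-- A binary-input channel packaged with its finite output alphabet. -/
structure Chan where
  Y : Type
  [finY : Fintype Y]
  W : Bool → Y → ℝ

attribute [instance] Chan.finY

/-- Equivalence of packaged channels: a bijection of output alphabets
identifying the transition probabilities. -/
def ChanEquiv (C₁ C₂ : Chan) : Prop :=
  ∃ f : C₁.Y ≃ C₂.Y, ∀ (x : Bool) (y : C₁.Y), C₁.W x y = C₂.W x (f y)

/-- The "plus" channel of the single-step polarization transform of `(C₁, C₂)`. -/
noncomputable def Chan.plus (C₁ C₂ : Chan) : Chan where
  Y := C₁.Y × C₂.Y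
  W := fun u₁ y => (1 / 2) * ∑ u₂ : Bool, C₁.W (xor u₁ u₂) y.1 * C₂.W u₂ y.2

/-- The "minus" channel of the single-step polarization transform of `(C₁, C₂)`. -/
noncomputable def Chan.minus (C₁ C₂ : Chan) : Chan where
  Y := C₁.Y × C₂.Y × Bool
  W := fun u₂ z => (1 / 2) * C₁.W (xor z.2.2 u₂) z.1 * C₂.W u₂ z.2.1

/-- The total erasure channel: a single output symbol produced with probability one. -/
def erasureChan : Chan where
  Y := Unit
  W := fun _ _ => 1

/-- The lower half `{s ∈ S : s < 2ⁿ}` of a subset `S ⊆ Fin 2ⁿ⁺¹`, viewed inside `Fin 2ⁿ`. -/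
def lowerHalf {n : ℕ} (S : Finset (Fin (2 ^ (n + 1)))) : Finset (Fin (2 ^ n)) :=
  Finset.univ.filter fun j =>
    (⟨j.val, lt_of_lt_of_le j.isLt (by rw [Nat.two_pow_succ]; exact Nat.le_add_right _ _)⟩ :
      Fin (2 ^ (n + 1))) ∈ S

/-- The upper half `{s − 2ⁿ : s ∈ S, s ≥ 2ⁿ}` of a subset `S ⊆ Fin 2ⁿ⁺¹`,
viewed inside `Fin 2ⁿ`. -/
def upperHalf {n : ℕ} (S : Finset (Fin (2 ^ (n + 1)))) : Finset (Fin (2 ^ n)) :=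
  Finset.univ.filter fun j =>
    (⟨j.val + 2 ^ n, by have := j.isLt; rw [Nat.two_pow_succ]; omega⟩ :
      Fin (2 ^ (n + 1))) ∈ S

/-- The subset bit-channels `W_{n,S}^{(i)}` of the recursive polarization construction
applied to the base channel `C` on the positions in `S` and the total erasure channel
on the positions outside `S`.  At level `n + 1`, the pair
`(W_{n+1,S}^{(2i)}, W_{n+1,S}^{(2i+1)})` is the single-step polarization transform of
`(W_{n,S₁}^{(i)}, W_{n,S₂}^{(i)})`, where `S₁, S₂` are the lower and upper halves of `S`. -/
noncomputable def bitChan (C : Chan) : (n : ℕ) → Finset (Fin (2 ^ n)) → Fin (2 ^ n) → Chan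
  | 0, S, _ => if (⟨0, Nat.two_pow_pos 0⟩ : Fin (2 ^ 0)) ∈ S then C else erasureChan
  | n + 1, S, i =>
    let i' : Fin (2 ^ n) := ⟨i.val / 2, by
      have h := i.isLt
      have h2 : 2 ^ (n + 1) = 2 ^ n + 2 ^ n := Nat.two_pow_succ n
      omega⟩
    if i.val % 2 = 0 then
      Chan.plus (bitChan C n (lowerHalf S) i') (bitChan C n (upperHalf S) i')
    else
      Chan.minus (bitChan C n (lowerHalf S) i') (bitChan C n (upperHalf S) i')

/-- Bitwise XOR on `Fin (2 ^ n)`, via the XOR of the `n`-bit binary representations. -/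
def finXor {n : ℕ} (s x : Fin (2 ^ n)) : Fin (2 ^ n) :=
  ⟨s.val ^^^ x.val, Nat.xor_lt_two_pow s.isLt x.isLt⟩

theorem ChanEquiv.refl (C : Chan) : ChanEquiv C C :=
  ⟨Equiv.refl _, fun _ _ => rfl⟩

theorem ChanEquiv.trans {A B C : Chan} (h₁ : ChanEquiv A B) (h₂ : ChanEquiv B C) :
    ChanEquiv A C := by
  obtain ⟨f, hf⟩ := h₁
  obtain ⟨g, hg⟩ := h₂
  exact ⟨f.trans g, fun x y => (hf x y).trans (hg x (f y))⟩

theorem Chan.plus_apply (A B : Chan) (u : Bool) (a : A.Y) (b : B.Y) :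
    (A.plus B).W u (a, b) = 1 / 2 * (A.W (!u) a * B.W true b + A.W u a * B.W false b) := by
  simp [Chan.plus]

theorem Chan.minus_apply (A B : Chan) (u : Bool) (a : A.Y) (b : B.Y) (c : Bool) :
    (A.minus B).W u (a, b, c) = 1 / 2 * A.W (xor c u) a * B.W u b :=
  rfl

theorem ChanEquiv.plus {A A' B B' : Chan} (h₁ : ChanEquiv A A') (h₂ : ChanEquiv B B') :
    ChanEquiv (A.plus B) (A'.plus B') := by
  obtain ⟨f, hf⟩ := h₁
  obtain ⟨g, hg⟩ := h₂
  refine ⟨Equiv.prodCongr f g, fun u ⟨a, b⟩ => ?_⟩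
  change _ = (A'.plus B').W u (f a, g b)
  simp only [Chan.plus_apply, hf, hg]

theorem ChanEquiv.minus {A A' B B' : Chan} (h₁ : ChanEquiv A A') (h₂ : ChanEquiv B B') :
    ChanEquiv (A.minus B) (A'.minus B') := by
  obtain ⟨f, hf⟩ := h₁
  obtain ⟨g, hg⟩ := h₂
  refine ⟨Equiv.prodCongr f (Equiv.prodCongr g (Equiv.refl Bool)), fun u ⟨a, b, c⟩ => ?_⟩
  change _ = (A'.minus B').W u (f a, g b, c)
  simp only [Chan.minus_apply, hf, hg]

/-- Flipping the input of the channel amounts to permuting its output alphabet. -/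
def Chan.IsSymm (C : Chan) : Prop :=
  ∃ π : C.Y ≃ C.Y, ∀ u y, C.W (!u) y = C.W u (π y)

theorem Chan.plus_comm (A B : Chan) : ChanEquiv (A.plus B) (B.plus A) := by
  refine ⟨Equiv.prodComm _ _, fun u ⟨a, b⟩ => ?_⟩
  change _ = (B.plus A).W u (b, a)
  cases u <;> simp only [Chan.plus_apply, Bool.not_true, Bool.not_false] <;> ring

theorem Chan.minus_comm {A B : Chan} (hA : A.IsSymm) (hB : B.IsSymm) :
    ChanEquiv (A.minus B) (B.minus A) := by
  obtain ⟨π, hπ⟩ := hA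
  obtain ⟨ρ, hρ⟩ := hB
  let e : A.Y × B.Y × Bool ≃ B.Y × A.Y × Bool :=
    { toFun := fun z => (bif z.2.2 then ρ z.2.1 else z.2.1, bif z.2.2 then π z.1 else z.1, z.2.2)
      invFun := fun z =>
        (bif z.2.2 then π.symm z.2.1 else z.2.1, bif z.2.2 then ρ.symm z.1 else z.1, z.2.2)
      left_inv := by rintro ⟨a, b, _ | _⟩ <;> simp
      right_inv := by rintro ⟨a, b, _ | _⟩ <;> simp }
  refine ⟨e, ?_⟩
  rintro x ⟨a, b, _ | _⟩
  · change _ = (B.minus A).W x (b, a, false)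
    simp only [Chan.minus_apply, Bool.false_xor]
    ring
  · change _ = (B.minus A).W x (ρ b, π a, true)
    simp only [Chan.minus_apply, Bool.true_xor, ← hπ, ← hρ, Bool.not_not]
    ring

theorem Chan.IsSymm.plus {A B : Chan} (hA : A.IsSymm) : (A.plus B).IsSymm := by
  obtain ⟨π, hπ⟩ := hA
  refine ⟨Equiv.prodCongr π (Equiv.refl _), fun u ⟨a, b⟩ => ?_⟩
  change _ = (A.plus B).W u (π a, b)
  simp only [Chan.plus_apply, ← hπ]

theorem Chan.IsSymm.minus {A B : Chan} (hA : A.IsSymm) (hB : B.IsSymm) :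
    (A.minus B).IsSymm := by
  obtain ⟨π, hπ⟩ := hA
  obtain ⟨ρ, hρ⟩ := hB
  refine ⟨Equiv.prodCongr π (Equiv.prodCongr ρ (Equiv.refl Bool)), fun u ⟨a, b, c⟩ => ?_⟩
  change _ = (A.minus B).W u (π a, ρ b, c)
  simp only [Chan.minus_apply, ← hπ, ← hρ, Bool.xor_not]

theorem isSymm_erasureChan : erasureChan.IsSymm :=
  ⟨Equiv.refl _, fun _ _ => rfl⟩

theorem Chan.IsSymm.bitChan {C : Chan} (hC : C.IsSymm) (n : ℕ) (S : Finset (Fin (2 ^ n)))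
    (i : Fin (2 ^ n)) : (bitChan C n S i).IsSymm := by
  induction n with
  | zero =>
    unfold _root_.bitChan
    split_ifs
    exacts [hC, isSymm_erasureChan]
  | succ n ih =>
    unfold _root_.bitChan
    dsimp only
    split_ifs
    exacts [(ih _ _).plus, (ih _ _).minus (ih _ _)]

theorem Nat.add_two_pow_eq_xor {n j : ℕ} (hj : j < 2 ^ n) : j + 2 ^ n = j ^^^ 2 ^ n := by
  refine Nat.eq_of_testBit_eq fun k => ?_
  rw [Nat.add_comm, Nat.testBit_xor, Nat.testBit_two_pow]
  rcases lt_trichotomy k n with h | rfl | h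
  · simp [Nat.testBit_two_pow_add_gt h, h.ne']
  · simp [Nat.testBit_two_pow_add_eq]
  · have h' : 2 ^ n + j < 2 ^ k :=
      lt_of_lt_of_le (by rw [Nat.pow_succ]; omega) (Nat.pow_le_pow_right (by omega) h)
    rw [Nat.testBit_lt_two_pow h', Nat.testBit_lt_two_pow (by omega : j < 2 ^ k)]
    simp [h.ne]

theorem finXor_finXor_cancel {n : ℕ} (s x : Fin (2 ^ n)) : finXor (finXor s x) x = s := by
  simp [finXor]

theorem mem_image_finXor {n : ℕ} (T : Finset (Fin (2 ^ n))) (x s : Fin (2 ^ n)) :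
    s ∈ T.image (fun t => finXor t x) ↔ finXor s x ∈ T := by
  rw [Finset.mem_image]
  constructor
  · rintro ⟨t, ht, rfl⟩
    rwa [finXor_finXor_cancel]
  · exact fun h => ⟨_, h, finXor_finXor_cancel s x⟩

theorem Chan.IsSymm.bitChan_equiv {C : Chan} (hC : C.IsSymm) (n : ℕ)
    (S T : Finset (Fin (2 ^ n))) (x i : Fin (2 ^ n)) (h : ∀ s, s ∈ S ↔ finXor s x ∈ T) :
    ChanEquiv (_root_.bitChan C n S i) (_root_.bitChan C n T i) := by
  induction n with
  | zero =>
    have hST : S = T := Finset.ext fun s => by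
      rw [h s, Subsingleton.elim (α := Fin 1) (finXor s x) s]
    rw [hST]
    exact ChanEquiv.refl _
  | succ n ih =>
    have hpow : 2 ^ (n + 1) = 2 ^ n + 2 ^ n := Nat.two_pow_succ n
    obtain ⟨x, hx⟩ := x
    unfold _root_.bitChan
    dsimp only
    by_cases hxn : x < 2 ^ n
    · have hlow : ∀ s, s ∈ lowerHalf S ↔ finXor s ⟨x, hxn⟩ ∈ lowerHalf T := fun s => by
        simp [lowerHalf, h, finXor]
      have hupp : ∀ s, s ∈ upperHalf S ↔ finXor s ⟨x, hxn⟩ ∈ upperHalf T := fun s => by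
        simp only [upperHalf, Finset.mem_filter_univ, h, finXor]
        simp only [Nat.add_two_pow_eq_xor s.isLt,
          Nat.add_two_pow_eq_xor (Nat.xor_lt_two_pow s.isLt hxn), Nat.xor_right_comm]
      split_ifs
      · exact (ih _ _ _ _ hlow).plus (ih _ _ _ _ hupp)
      · exact (ih _ _ _ _ hlow).minus (ih _ _ _ _ hupp)
    · obtain ⟨y, rfl⟩ : ∃ y, x = y + 2 ^ n := ⟨x - 2 ^ n, by omega⟩
      have hy : y < 2 ^ n := by omega
      have hlow : ∀ s, s ∈ lowerHalf S ↔ finXor s ⟨y, hy⟩ ∈ upperHalf T := fun s => by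
        simp only [lowerHalf, upperHalf, Finset.mem_filter_univ, h, finXor]
        simp only [Nat.add_two_pow_eq_xor hy,
          Nat.add_two_pow_eq_xor (Nat.xor_lt_two_pow s.isLt hy), Nat.xor_assoc]
      have hupp : ∀ s, s ∈ upperHalf S ↔ finXor s ⟨y, hy⟩ ∈ lowerHalf T := fun s => by
        simp only [lowerHalf, upperHalf, Finset.mem_filter_univ, h, finXor]
        simp only [Nat.add_two_pow_eq_xor hy, Nat.add_two_pow_eq_xor s.isLt, ← Nat.xor_assoc,
          Nat.xor_right_comm s.val (2 ^ n) y, Nat.xor_xor_cancel_right]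
      split_ifs
      · exact ((ih _ _ _ _ hlow).plus (ih _ _ _ _ hupp)).trans (Chan.plus_comm _ _)
      · exact ((ih _ _ _ _ hlow).minus (ih _ _ _ _ hupp)).trans
          (Chan.minus_comm (hC.bitChan _ _ _) (hC.bitChan _ _ _))

/-- **Equivalent subsets give equivalent bit-channels.**  If `W` is a symmetric
binary-input channel and `S = T ⊕̲ x` are equivalent subsets of `Fin 2ⁿ`, then for every
index `i` the subset bit-channels `W_{n,S}^{(i)}` and `W_{n,T}^{(i)}` are equivalent. -/
theorem bitChan_equiv_of_equivalent_subsets {Y : Type} [Fintype Y]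
    (W : Bool → Y → ℝ) (hW : IsChannel W)
    (hsym : ∃ π : Y ≃ Y, (∀ y, π (π y) = y) ∧ ∀ y, W true y = W false (π y))
    (n : ℕ) (hn : 1 ≤ n)
    (S T : Finset (Fin (2 ^ n))) (x : Fin (2 ^ n))
    (hST : S = T.image fun t => finXor t x) :
    ∀ i : Fin (2 ^ n),
      ChanEquiv (bitChan { Y := Y, W := W } n S i) (bitChan { Y := Y, W := W } n T i) := by
  obtain ⟨π, hπ, hW'⟩ := hsym
  have hC : Chan.IsSymm { Y := Y, W := W } := ⟨π, fun u y => by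
    cases u
    · exact hW' y
    · simp [hW', hπ]⟩
  subst hST
  exact fun i => hC.bitChan_equiv n _ _ x i (mem_image_finXor T x)
end
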